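/- (Linear independence of the four Dirichlet-center translates.) For every θ ∈ (5π/6, π], the four vectors p₀, p₁₂, p₁₃, p₁₄ ∈ ℂ⁴ are linearly independent over ℂ; equivalently, the determinant of the 4×4 matrix with columns p₀, p₁₂, p₁₃, p₁₄ is nonzero. At θ = 5π/6 these four vectors are linearly dependent (the determinant vanishes). -/

import Mathlib

open Complex ComplexConjugate Matrix Polynomial

noncomputable section

/-- Signature (3,1) weights of the Hermitian form `H = diag(1,1,1,-1)`. -/
def eta4 : Fin 4 → ℂ := ![1, 1, 1, -1]

/-- The Hermitian matrix `H = diag(1,1,1,-1)`. -/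
def H4 : Matrix (Fin 4) (Fin 4) ℂ := Matrix.diagonal eta4

/-- The Hermitian form `⟨z,w⟩ = z₁ conj w₁ + z₂ conj w₂ + z₃ conj w₃ - z₄ conj w₄`. -/
def herm4 (z w : Fin 4 → ℂ) : ℂ :=
  z 0 * conj (w 0) + z 1 * conj (w 1) + z 2 * conj (w 2) - z 3 * conj (w 3)

/-- The (real) value `⟨z,z⟩` of the Hermitian form. -/
def q4 (z : Fin 4 → ℂ) : ℝ :=
  Complex.normSq (z 0) + Complex.normSq (z 1) + Complex.normSq (z 2) - Complex.normSq (z 3)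

/-- The order-4 symmetry `J = diag(-1, i, -i, 1)`. -/
def J4 : Matrix (Fin 4) (Fin 4) ℂ := Matrix.diagonal ![-1, Complex.I, -Complex.I, 1]

/-- The polar vector `n₁` of the paper. -/
def n1v (θ : ℝ) : Fin 4 → ℂ :=
  ![((Real.sqrt (1 - 2 * Real.cos θ) / 2 : ℝ) : ℂ),
    ((Real.sqrt (1 - 2 * Real.sin θ) / 2 : ℝ) : ℂ),
    ((Real.sqrt (1 + 2 * Real.sin θ) / 2 : ℝ) : ℂ),
    ((Real.sqrt (-1 - 2 * Real.cos θ) / 2 : ℝ) : ℂ)]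

/-- `nvec θ k` is the vector `n_{k+1}` of the paper, i.e. `J^k n₁`. -/
def nvec (θ : ℝ) (k : Fin 4) : Fin 4 → ℂ := (J4 ^ (k : ℕ)).mulVec (n1v θ)

/-- The matrix of the order-two complex reflection `z ↦ -z + 2⟨z,n⟩ n`. -/
def refl4 (n : Fin 4 → ℂ) : Matrix (Fin 4) (Fin 4) ℂ :=
  -(1 : Matrix (Fin 4) (Fin 4) ℂ) +
    (2 : ℂ) • Matrix.vecMulVec n (fun k => conj (n k) * eta4 k)

/-- `Iref θ k` is the complex reflection `I_{k+1}` of the paper. -/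
def Iref (θ : ℝ) (k : Fin 4) : Matrix (Fin 4) (Fin 4) ℂ := refl4 (nvec θ k)

/-- `Amat θ k` is `A_{k+1} = I_{k+1} · I_{k+2}` (indices mod 4). -/
def Amat (θ : ℝ) (k : Fin 4) : Matrix (Fin 4) (Fin 4) ℂ := Iref θ k * Iref θ (k + 1)

/-- The Dirichlet center `p₀ = (0,0,0,1)ᵗ`. -/
def p0v : Fin 4 → ℂ := ![0, 0, 0, 1]

/-- `pv θ i j` is `p_{(i+1)(j+1)} = I_{i+1} I_{j+1} p₀`. -/
def pv (θ : ℝ) (i j : Fin 4) : Fin 4 → ℂ := (Iref θ i * Iref θ j).mulVec p0v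

/-- The 4×4 matrix whose columns are `p₀, p₁₂, p₁₃, p₁₄`. -/
def colMat (θ : ℝ) : Matrix (Fin 4) (Fin 4) ℂ :=
  Matrix.of fun i j => (![p0v, pv θ 0 1, pv θ 0 2, pv θ 0 3] j) i

lemma nvec_apply (θ : ℝ) (k i : Fin 4) :
    nvec θ k i = (![-1, Complex.I, -Complex.I, 1] i) ^ (k : ℕ) * n1v θ i := by
  simp [nvec, J4, Matrix.diagonal_pow, Matrix.mulVec_diagonal]

lemma refl4_mulVec (n z : Fin 4 → ℂ) (i : Fin 4) :
    (refl4 n).mulVec z i = - z i + 2 * herm4 z n * n i := by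
  simp only [refl4, Matrix.add_mulVec, Matrix.neg_mulVec, Matrix.one_mulVec, Matrix.smul_mulVec,
    Matrix.vecMulVec_mulVec, Pi.add_apply, Pi.neg_apply, Pi.smul_apply, herm4, eta4]
  simp [dotProduct, Fin.sum_univ_four]
  ring

lemma pv_apply (θ : ℝ) (k i : Fin 4) (A B C D : ℝ) (hn : n1v θ = ![(A : ℂ), B, C, D]) :
    pv θ 0 k i = p0v i + 2 * D * (n1v θ i) + 2 * D * nvec θ k i
      - 4 * D * herm4 (nvec θ k) (n1v θ) * n1v θ i := by
  have h0 : nvec θ 0 = n1v θ := by ext j; simp [nvec_apply]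
  have hp : ∀ k, herm4 p0v (nvec θ k) = - D := by
    intro k
    simp [herm4, p0v, nvec_apply, hn]
  have h1 : (refl4 (nvec θ k)).mulVec p0v = fun j => - p0v j + 2 * (-D) * nvec θ k j := by
    ext j; rw [refl4_mulVec, hp]
  have hp0 := hp 0
  rw [h0] at hp0
  rw [pv, Iref, Iref, ← Matrix.mulVec_mulVec, h1, refl4_mulVec, h0]
  have : herm4 (fun j => - p0v j + 2 * (-D) * nvec θ k j) (n1v θ)
      = - herm4 p0v (n1v θ) - 2 * D * herm4 (nvec θ k) (n1v θ) := by
    simp only [herm4]; ring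
  rw [this, hp0]; ring

lemma colMat_det_aux (θ A B C D : ℝ) (hn : n1v θ = ![(A : ℂ), B, C, D])
    (h : A ^ 2 = B ^ 2 + C ^ 2 + D ^ 2) :
    (colMat θ).det = Complex.I * (64 * A * B * C * D ^ 3 * (1 + 2 * A ^ 2 + 2 * D ^ 2) : ℝ) := by
  have hI : Complex.I ^ 2 = -1 := Complex.I_sq
  have hI3 : Complex.I ^ 3 = -Complex.I := Complex.I_pow_three
  have h' : (A : ℂ) ^ 2 = B ^ 2 + C ^ 2 + D ^ 2 := by exact_mod_cast h
  have hs : ∀ (z : ℂ), (-z) ^ 3 = - z ^ 3 := fun z => by ring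
  have g1 : herm4 (nvec θ 1) (n1v θ) = - A ^ 2 - D ^ 2 + Complex.I * (B ^ 2 - C ^ 2) := by
    simp [herm4, nvec_apply, hn]; ring
  have g2 : herm4 (nvec θ 2) (n1v θ) = 0 := by
    simp [herm4, nvec_apply, hn]; linear_combination h'
  have g3 : herm4 (nvec θ 3) (n1v θ) = - A ^ 2 - D ^ 2 - Complex.I * (B ^ 2 - C ^ 2) := by
    simp [herm4, nvec_apply, hn, hI3, hs]; ring
  have q1 := fun i => pv_apply θ 1 i A B C D hn
  have q2 := fun i => pv_apply θ 2 i A B C D hn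
  have q3 := fun i => pv_apply θ 3 i A B C D hn
  rw [g1] at q1
  rw [g2] at q2
  rw [g3] at q3
  have c0 : ∀ i, colMat θ i 0 = p0v i := fun i => rfl
  have c1 : ∀ i, colMat θ i 1 = pv θ 0 1 i := fun i => rfl
  have c2 : ∀ i, colMat θ i 2 = pv θ 0 2 i := fun i => rfl
  have c3 : ∀ i, colMat θ i 3 = pv θ 0 3 i := fun i => rfl
  have e : colMat θ = !![p0v 0, pv θ 0 1 0, pv θ 0 2 0, pv θ 0 3 0;
      p0v 1, pv θ 0 1 1, pv θ 0 2 1, pv θ 0 3 1;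
      p0v 2, pv θ 0 1 2, pv θ 0 2 2, pv θ 0 3 2;
      p0v 3, pv θ 0 1 3, pv θ 0 2 3, pv θ 0 3 3] := by
    ext i j; fin_cases i <;> fin_cases j <;> rfl
  rw [e]
  simp only [q1, q2, q3]
  simp [Matrix.det_succ_column_zero, Fin.sum_univ_succ, Fin.succAbove, p0v, nvec_apply, hn, hI3, hs]
  ring_nf

lemma colMat_det (θ : ℝ) (h1 : 5 * Real.pi / 6 ≤ θ) (h2 : θ ≤ Real.pi) :
    ∃ A B C D : ℝ, 0 < A ∧ 0 < C ∧ 0 < D ∧ B = Real.sqrt (1 - 2 * Real.sin θ) / 2 ∧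
    (colMat θ).det = Complex.I * (64 * A * B * C * D ^ 3 * (1 + 2 * A ^ 2 + 2 * D ^ 2) : ℝ) := by
  have hpi := Real.pi_pos
  have hsin0 : 0 ≤ Real.sin θ := Real.sin_nonneg_of_nonneg_of_le_pi (by linarith) h2
  have hsin : Real.sin θ ≤ 1 / 2 := by
    rw [← Real.sin_pi_div_six, ← Real.sin_pi_sub θ]
    exact Real.sin_le_sin_of_le_of_le_pi_div_two (by linarith) (by linarith) (by linarith)
  have hcos : Real.cos θ < - (1 / 2) := by
    have hc : Real.cos θ < 0 := Real.cos_neg_of_pi_div_two_lt_of_lt (by linarith) (by linarith)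
    nlinarith [Real.sin_sq_add_cos_sq θ]
  refine ⟨Real.sqrt (1 - 2 * Real.cos θ) / 2, _, Real.sqrt (1 + 2 * Real.sin θ) / 2,
    Real.sqrt (-1 - 2 * Real.cos θ) / 2, ?_, ?_, ?_, rfl, ?_⟩
  · have := Real.sqrt_pos.2 (show 0 < 1 - 2 * Real.cos θ by linarith)
    positivity
  · have := Real.sqrt_pos.2 (show 0 < 1 + 2 * Real.sin θ by linarith)
    positivity
  · have := Real.sqrt_pos.2 (show 0 < -1 - 2 * Real.cos θ by linarith)
    positivity
  · apply colMat_det_aux θ _ _ _ _ rfl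
    simp only [div_pow]
    rw [Real.sq_sqrt (by linarith), Real.sq_sqrt (by linarith), Real.sq_sqrt (by linarith),
      Real.sq_sqrt (by linarith)]
    ring

lemma linInd_iff (θ : ℝ) :
    LinearIndependent ℂ ![p0v, pv θ 0 1, pv θ 0 2, pv θ 0 3] ↔ (colMat θ).det ≠ 0 := by
  rw [← isUnit_iff_ne_zero, ← Matrix.isUnit_iff_isUnit_det,
    ← Matrix.linearIndependent_cols_iff_isUnit]
  rfl

/-- for every `θ ∈ (5π/6, π]` the four vectors `p₀, p₁₂, p₁₃, p₁₄`
are linearly independent over `ℂ` (equivalently the determinant of the matrix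
with these columns is nonzero), while at `θ = 5π/6` they are linearly dependent
(the determinant vanishes). -/
theorem translates_linearly_independent :
    (∀ θ ∈ Set.Ioc (5 * Real.pi / 6) Real.pi,
      LinearIndependent ℂ ![p0v, pv θ 0 1, pv θ 0 2, pv θ 0 3] ∧
      (colMat θ).det ≠ 0) ∧
    (colMat (5 * Real.pi / 6)).det = 0 ∧
    ¬ LinearIndependent ℂ
        ![p0v, pv (5 * Real.pi / 6) 0 1, pv (5 * Real.pi / 6) 0 2,
          pv (5 * Real.pi / 6) 0 3] := by
  have hpi := Real.pi_pos
  have hz : (colMat (5 * Real.pi / 6)).det = 0 := by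
    obtain ⟨A, B, C, D, -, -, -, hB, h⟩ := colMat_det (5 * Real.pi / 6) le_rfl (by linarith)
    have hs : Real.sin (5 * Real.pi / 6) = 1 / 2 := by
      rw [← Real.sin_pi_div_six, ← Real.sin_pi_sub (Real.pi / 6)]
      congr 1; ring
    have hB0 : B = 0 := by rw [hB, hs]; norm_num
    rw [h, hB0]; simp
  refine ⟨fun θ hθ => ?_, hz, fun hl => (linInd_iff _).1 hl hz⟩
  suffices hd : (colMat θ).det ≠ 0 from ⟨(linInd_iff θ).2 hd, hd⟩
  obtain ⟨h1, h2⟩ := hθ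
  obtain ⟨A, B, C, D, hA, hC, hD, hB, h⟩ := colMat_det θ h1.le h2
  have hsin : Real.sin θ < 1 / 2 := by
    rw [← Real.sin_pi_div_six, ← Real.sin_pi_sub θ]
    exact Real.sin_lt_sin_of_lt_of_le_pi_div_two (by linarith) (by linarith) (by linarith)
  have hB0 : 0 < B := by
    have := Real.sqrt_pos.2 (show 0 < 1 - 2 * Real.sin θ by linarith)
    rw [hB]; positivity
  rw [h]
  refine mul_ne_zero Complex.I_ne_zero ?_
  rw [Complex.ofReal_ne_zero]
  positivity
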